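/- arXiv:2404.08349 — 3 statements merged into one kernel-verified Lean document; each statement's English description precedes it below -/
import Mathlib

section
/- Let p : ℝ → ℝ be a continuous 2π-periodic function with real Fourier coefficients a_k = (1/π)∫₀^{2π} p(φ) cos(kφ) dφ and b_k = (1/π)∫₀^{2π} p(φ) sin(kφ) dφ for k ≥ 1, and set L = ∫₀^{2π} p(φ) dφ and a(φ) = p(φ) + p(φ + π). Then 2π ∫₀^{2π} a(φ)² dφ = 4L² + 8π² Σ_{k ≥ 2, k even} (a_k² + b_k²). -/
open MeasureTheory Real Filter Topology

noncomputable section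

/-- The integral over `[0, 2c]` folds onto `[0, c]`. -/
theorem integral_zero_two_mul_eq_integral_add_shift {E : Type*} [NormedAddCommGroup E]
    [NormedSpace ℝ E] {f : ℝ → E} (hf : Continuous f) (c : ℝ) :
    ∫ x in (0 : ℝ)..(2 * c), f x = ∫ x in (0 : ℝ)..c, (f x + f (x + c)) := by
  have hshift : Continuous fun x => f (x + c) := by fun_prop
  rw [intervalIntegral.integral_add (hf.intervalIntegrable _ _) (hshift.intervalIntegrable _ _),
    intervalIntegral.integral_comp_add_right, zero_add, ← two_mul,
    intervalIntegral.integral_add_adjacent_intervals (hf.intervalIntegrable _ _)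
      (hf.intervalIntegrable _ _)]

/-- The Fourier coefficients of the width function on `[0, π]` are the even Fourier coefficients
of `p` on `[0, 2π]`. -/
theorem fourierCoeffOn_width {p : ℝ → ℝ} (hp : Continuous p) (n : ℤ) :
    fourierCoeffOn pi_pos (fun x => ((p x + p (x + π) : ℝ) : ℂ)) n =
      (((1 / π) * ∫ φ in (0 : ℝ)..(2 * π), p φ * Real.cos (2 * n * φ) : ℝ) : ℂ) -
      (((1 / π) * ∫ φ in (0 : ℝ)..(2 * π), p φ * Real.sin (2 * n * φ) : ℝ) : ℂ) * Complex.I := by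
  have hfold (q : ℝ → ℝ) (hq : Continuous q) (hqper : ∀ x, q (x + π) = q x) :
      ∫ φ in (0 : ℝ)..(2 * π), p φ * q φ = ∫ φ in (0 : ℝ)..π, (p φ + p (φ + π)) * q φ := by
    rw [integral_zero_two_mul_eq_integral_add_shift (f := fun φ => p φ * q φ) (hp.mul hq)]
    simp only [hqper, add_mul]
  have hcos : ∀ x : ℝ, Real.cos (2 * n * (x + π)) = Real.cos (2 * n * x) := fun x => by
    rw [← Real.cos_add_int_mul_two_pi (2 * n * x) n]
    ring_nf
  have hsin : ∀ x : ℝ, Real.sin (2 * n * (x + π)) = Real.sin (2 * n * x) := fun x => by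
    rw [← Real.sin_add_int_mul_two_pi (2 * n * x) n]
    ring_nf
  rw [fourierCoeffOn_eq_integral, hfold _ (by fun_prop) hcos, hfold _ (by fun_prop) hsin]
  have hpt : ∀ x : ℝ, fourier (-n) (x : AddCircle (π - 0)) • ((p x + p (x + π) : ℝ) : ℂ) =
      (((p x + p (x + π)) * Real.cos (2 * n * x) : ℝ) : ℂ) -
      (((p x + p (x + π)) * Real.sin (2 * n * x) : ℝ) : ℂ) * Complex.I := fun x => by
    have harg : 2 * (π : ℂ) * Complex.I * ((-n : ℤ) : ℂ) * x / ((π - 0 : ℝ) : ℂ) =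
        ((-(2 * n * x) : ℝ) : ℂ) * Complex.I := by
      have : (π : ℂ) ≠ 0 := by exact_mod_cast pi_ne_zero
      push_cast
      field_simp
      rw [sub_zero]
      ring
    rw [fourier_coe_apply, harg, Complex.exp_mul_I, ← Complex.ofReal_cos, ← Complex.ofReal_sin,
      Real.cos_neg, Real.sin_neg, smul_eq_mul]
    push_cast
    ring
  have hint (q : ℝ → ℝ) (hq : Continuous q) :
      IntervalIntegrable (fun x => (((p x + p (x + π)) * q x : ℝ) : ℂ)) volume 0 π :=
    Continuous.intervalIntegrable (by fun_prop) _ _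
  simp only [hpt]
  rw [intervalIntegral.integral_sub (hint _ (by fun_prop))
      ((hint _ (by fun_prop)).mul_const _), intervalIntegral.integral_mul_const,
    intervalIntegral.integral_ofReal, intervalIntegral.integral_ofReal, Complex.real_smul]
  push_cast
  ring

/-- For a continuous `2π`-periodic function `p` with Fourier coefficients `a_k, b_k`,
width function `a(φ) = p(φ) + p(φ + π)` and `L = ∫₀^{2π} p`, one has
`2π ∫₀^{2π} a(φ)² dφ = 4 L² + 8 π² Σ_{k ≥ 2 even} (a_k² + b_k²)`. -/
theorem width_square_integral (p : ℝ → ℝ) (hp : Continuous p)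
    (hper : ∀ x : ℝ, p (x + 2 * π) = p x) :
    2 * π * ∫ φ in (0 : ℝ)..(2 * π), (p φ + p (φ + π)) ^ 2 =
      4 * (∫ φ in (0 : ℝ)..(2 * π), p φ) ^ 2 +
      8 * π ^ 2 * ∑' m : ℕ,
        (((1 / π) * ∫ φ in (0 : ℝ)..(2 * π), p φ * Real.cos (((2 * (m + 1) : ℕ) : ℝ) * φ)) ^ 2 +
         ((1 / π) * ∫ φ in (0 : ℝ)..(2 * π), p φ * Real.sin (((2 * (m + 1) : ℕ) : ℝ) * φ)) ^ 2) := by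
  have hL2 : MemLp (fun x => ((p x + p (x + π) : ℝ) : ℂ)) 2 (volume.restrict (Set.Ioc 0 π)) :=
    (memLp_two_iff_integrable_sq_norm (Continuous.aestronglyMeasurable (by fun_prop))).mpr
      (Continuous.integrableOn_Ioc (by fun_prop))
  have hnorm : ∀ u v : ℝ, ‖(u : ℂ) - (v : ℂ) * Complex.I‖ ^ 2 = u ^ 2 + v ^ 2 := fun u v => by
    rw [← Complex.normSq_eq_norm_sq, Complex.normSq_apply]
    simp
    ring
  have hparseval := hasSum_sq_fourierCoeffOn pi_pos hL2
  simp only [fourierCoeffOn_width hp, hnorm, Complex.norm_real, norm_eq_abs, sq_abs] at hparseval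
  have hsum := (hasSum_nat_add_iff' 1).mpr hparseval.nat_add_neg
  have hwidth : ∫ φ in (0 : ℝ)..(2 * π), (p φ + p (φ + π)) ^ 2 =
      2 * ∫ φ in (0 : ℝ)..π, (p φ + p (φ + π)) ^ 2 := by
    have hshift : ∀ x, p (x + π + π) = p x := fun x => by rw [← hper x]; ring_nf
    rw [integral_zero_two_mul_eq_integral_add_shift (by fun_prop),
      ← intervalIntegral.integral_const_mul]
    congr 1 with x
    rw [hshift]
    ring
  have htsum := (hsum.div_const 2).tsum_eq
  simp only [Int.cast_neg, Int.cast_natCast, mul_neg, neg_mul, Real.cos_neg, Real.sin_neg,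
    intervalIntegral.integral_neg, neg_sq, add_self_div_two] at htsum
  push_cast at htsum ⊢
  rw [htsum, hwidth]
  simp
  field_simp
  ring

end
end

section
/- Let g : ℝ → ℝ be a continuous 2π-periodic function with complex Fourier coefficients c_k = (1/2π) ∫₀^{2π} g(φ) e^{−ikφ} dφ for k ∈ ℤ. Then the function φ ↦ g(φ) + g(φ + π/2) is constant if and only if c_k = 0 for every integer k ≠ 0 with k not congruent to 2 modulo 4. -/
open MeasureTheory Real Filter Topology

noncomputable section

/-- Translating a periodic function multiplies its Fourier integrals by a phase. -/
lemma integral_translate_mul_exp {f : ℝ → ℂ} (hper : Function.Periodic f (2 * π)) (a : ℝ) (k : ℤ) :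
    ∫ φ in (0 : ℝ)..(2 * π), f (φ + a) * Complex.exp (-Complex.I * k * φ) =
      Complex.exp (Complex.I * k * a) *
        ∫ φ in (0 : ℝ)..(2 * π), f φ * Complex.exp (-Complex.I * k * φ) := by
  set F : ℝ → ℂ := fun φ => f φ * Complex.exp (-Complex.I * k * φ) with hF
  have hFper : Function.Periodic F (2 * π) := by
    intro x
    have h : -Complex.I * k * ((x + 2 * π : ℝ) : ℂ) =
        -Complex.I * k * x + (-k : ℤ) * (2 * π * Complex.I) := by
      push_cast
      ring
    simp only [hF, hper x]
    rw [h, Complex.exp_add, Complex.exp_int_mul_two_pi_mul_I, mul_one]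
  have hshift : ∀ φ : ℝ, f (φ + a) * Complex.exp (-Complex.I * k * φ) =
      Complex.exp (Complex.I * k * a) * F (φ + a) := by
    intro φ
    have h : -Complex.I * k * φ =
        Complex.I * k * a + -Complex.I * k * ((φ + a : ℝ) : ℂ) := by
      push_cast
      ring
    simp only [hF]
    rw [h, Complex.exp_add]
    ring
  simp_rw [hshift]
  rw [intervalIntegral.integral_const_mul, intervalIntegral.integral_comp_add_right]
  have h := hFper.intervalIntegral_add_eq a 0
  rw [zero_add, add_comm a] at h
  rw [zero_add, h]

lemma exp_I_mul_int_mul_pi_div_two_eq_neg_one_iff (k : ℤ) :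
    Complex.exp (Complex.I * k * (π / 2 : ℝ)) = -1 ↔ k ≡ 2 [ZMOD 4] := by
  have hπ : (π : ℂ) ≠ 0 := Complex.ofReal_ne_zero.mpr pi_ne_zero
  rw [← Complex.exp_pi_mul_I, Complex.exp_eq_exp_iff_exists_int]
  constructor
  · rintro ⟨n, hn⟩
    have h : (k : ℂ) = 2 + 4 * n := by
      push_cast at hn
      have h0 : (Complex.I * π) * ((k : ℂ) - (2 + 4 * n)) = 0 := by linear_combination 2 * hn
      rcases mul_eq_zero.mp h0 with h0 | h0
      · exact absurd h0 (mul_ne_zero Complex.I_ne_zero hπ)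
      · exact sub_eq_zero.mp h0
    have h' : k = 2 + 4 * n := by exact_mod_cast h
    rw [Int.ModEq]
    omega
  · intro h
    refine ⟨k / 4, ?_⟩
    have h' : k = 2 + 4 * (k / 4) := by
      rw [Int.ModEq] at h
      omega
    have h'' : (k : ℂ) = 2 + 4 * ((k / 4 : ℤ) : ℂ) := by exact_mod_cast h'
    push_cast
    linear_combination (Complex.I * π / 2) * h''

lemma integral_exp_neg_I_mul_int_eq_zero {k : ℤ} (hk : k ≠ 0) :
    ∫ φ in (0 : ℝ)..(2 * π), Complex.exp (-Complex.I * k * φ) = 0 := by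
  have hk' : -Complex.I * (k : ℂ) ≠ 0 :=
    mul_ne_zero (neg_ne_zero.mpr Complex.I_ne_zero) (Int.cast_ne_zero.mpr hk)
  have h : -Complex.I * k * ((2 * π : ℝ) : ℂ) = (-k : ℤ) * (2 * π * Complex.I) := by
    push_cast
    ring
  rw [integral_exp_mul_complex hk', h, Complex.exp_int_mul_two_pi_mul_I]
  simp

/-- A continuous periodic function whose nonconstant Fourier integrals all vanish is constant. -/
lemma eq_of_forall_integral_mul_exp_eq_zero {f : ℝ → ℂ} (hf : Continuous f)
    (hper : Function.Periodic f (2 * π))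
    (h : ∀ k : ℤ, k ≠ 0 →
      ∫ φ in (0 : ℝ)..(2 * π), f φ * Complex.exp (-Complex.I * k * φ) = 0) (x y : ℝ) :
    f x = f y := by
  have : Fact (0 < 2 * π) := ⟨two_pi_pos⟩
  let F : C(AddCircle (2 * π), ℂ) := ⟨hper.lift, hf.quotient_lift _⟩
  have hF : ∀ x : ℝ, F x = f x := fun x => rfl
  have hcoeff : ∀ k : ℤ, k ≠ 0 → fourierCoeff F k = 0 := by
    intro k hk
    rw [fourierCoeff_eq_intervalIntegral F k 0, zero_add]
    have hint : ∫ φ in (0 : ℝ)..(2 * π), fourier (-k) (φ : AddCircle (2 * π)) • F φ =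
        ∫ φ in (0 : ℝ)..(2 * π), f φ * Complex.exp (-Complex.I * k * φ) := by
      refine intervalIntegral.integral_congr fun φ _ => ?_
      have hπ : (π : ℂ) ≠ 0 := Complex.ofReal_ne_zero.mpr pi_ne_zero
      simp only [hF, smul_eq_mul]
      rw [fourier_coe_apply, mul_comm]
      congr 2
      push_cast
      field_simp
    rw [hint, h k hk, smul_zero]
  have hsum : Summable (fourierCoeff F) :=
    summable_of_ne_finset_zero (s := {0}) fun k hk => hcoeff k (by simpa using hk)
  have hval : ∀ x : ℝ, f x = fourierCoeff F 0 := by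
    intro x
    have h1 := has_pointwise_sum_fourier_series_of_summable hsum (x : AddCircle (2 * π))
    have h2 := hasSum_single (f := fun i => fourierCoeff F i • fourier i (x : AddCircle (2 * π))) 0
      fun k hk => by simp [hcoeff k hk]
    simpa [hF] using h1.unique h2
  rw [hval x, hval y]

/-- For a continuous `2π`-periodic `g` with complex Fourier coefficients `c_k`,
`φ ↦ g(φ) + g(φ + π/2)` is constant iff `c_k = 0` for every `k ≠ 0` with
`k` not congruent to `2` modulo `4`. -/
theorem constant_sum_iff_fourier (g : ℝ → ℝ) (hg : Continuous g)
    (hper : ∀ x : ℝ, g (x + 2 * π) = g x) :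
    (∃ C : ℝ, ∀ φ : ℝ, g φ + g (φ + π / 2) = C) ↔
    (∀ k : ℤ, k ≠ 0 → ¬ (k ≡ 2 [ZMOD 4]) →
      (1 / (2 * (π : ℂ))) *
        ∫ φ in (0 : ℝ)..(2 * π), (g φ : ℂ) * Complex.exp (-Complex.I * k * φ) = 0) := by
  have hπ : 1 / (2 * (π : ℂ)) ≠ 0 :=
    one_div_ne_zero (mul_ne_zero two_ne_zero (Complex.ofReal_ne_zero.mpr pi_ne_zero))
  have hgper : Function.Periodic (fun φ => (g φ : ℂ)) (2 * π) := fun x => by simp [hper x]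
  have hsum : ∀ k : ℤ, ∫ φ in (0 : ℝ)..(2 * π),
      ((g φ + g (φ + π / 2) : ℝ) : ℂ) * Complex.exp (-Complex.I * k * φ) =
      (1 + Complex.exp (Complex.I * k * (π / 2 : ℝ))) *
        ∫ φ in (0 : ℝ)..(2 * π), (g φ : ℂ) * Complex.exp (-Complex.I * k * φ) := by
    intro k
    rw [add_mul, one_mul, ← integral_translate_mul_exp hgper, ← intervalIntegral.integral_add]
    · simp_rw [Complex.ofReal_add, add_mul]
    · exact Continuous.intervalIntegrable (by fun_prop) _ _
    · exact Continuous.intervalIntegrable (by fun_prop) _ _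
  simp only [mul_eq_zero, hπ, false_or]
  constructor
  · rintro ⟨C, hC⟩ k hk hk4
    have h := hsum k
    simp_rw [hC] at h
    rw [intervalIntegral.integral_const_mul, integral_exp_neg_I_mul_int_eq_zero hk, mul_zero] at h
    refine (mul_eq_zero.mp h.symm).resolve_left fun h0 => hk4 ?_
    exact (exp_I_mul_int_mul_pi_div_two_eq_neg_one_iff k).mp (eq_neg_of_add_eq_zero_right h0)
  · intro h
    refine ⟨g 0 + g (0 + π / 2), fun φ => Complex.ofReal_injective ?_⟩
    refine eq_of_forall_integral_mul_exp_eq_zero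
      (f := fun φ => ((g φ + g (φ + π / 2) : ℝ) : ℂ)) (by fun_prop) ?_ ?_ φ 0
    · intro x
      simp only [add_right_comm x, hper]
    · intro k hk
      rw [hsum k]
      by_cases hk4 : k ≡ 2 [ZMOD 4]
      · rw [(exp_I_mul_int_mul_pi_div_two_eq_neg_one_iff k).mpr hk4, add_neg_cancel, zero_mul]
      · rw [h k hk hk4, mul_zero]

end
end

section
/- Let p : ℝ → ℝ be a continuous 2π-periodic function with real Fourier coefficients a_k = (1/π)∫₀^{2π} p(φ) cos(kφ) dφ and b_k = (1/π)∫₀^{2π} p(φ) sin(kφ) dφ for k ≥ 1, and set L = ∫₀^{2π} p(φ) dφ. Then for every α ∈ ℝ, ∫₀^{2π} p(φ)·p(φ + π − α) dφ = L²/(2π) − π Σ_{k ≥ 1} (−1)^{k+1} (a_k² + b_k²) cos(kα). -/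
open MeasureTheory Real Filter Topology

noncomputable section

open ComplexConjugate AddCircle

theorem fourierCoeff_comp_add_right {T : ℝ} [Fact (0 < T)] (f : AddCircle T → ℂ)
    (b : AddCircle T) (n : ℤ) :
    fourierCoeff (fun x => f (x + b)) n = fourier n b * fourierCoeff f n := by
  have h := integral_add_right_eq_self (μ := haarAddCircle (T := T))
    (fun t => fourier n b * (fourier (-n) t • f t)) b
  rw [fourierCoeff, fourierCoeff, ← integral_const_mul, ← h]
  congr 1 with t
  have e : fourier n b * fourier (-n) b = (1 : ℂ) := by
    rw [← fourier_add', add_neg_cancel, zero_smul, fourier_zero']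
  have e2 : fourier (-n) (t + b) = fourier (-n) t * (fourier (-n) b : ℂ) := by
    simp [fourier_apply, smul_add, toCircle_add]
  simp only [smul_eq_mul, e2]
  linear_combination (-fourier (-n) t * f (t + b)) * e

/-- **Parseval's identity** for the autocorrelation of a continuous function on the circle. -/
theorem hasSum_fourier_mul_normSq_fourierCoeff {T : ℝ} [Fact (0 < T)]
    (f : C(AddCircle T, ℂ)) (b : AddCircle T) :
    HasSum (fun n : ℤ => fourier n b * (Complex.normSq (fourierCoeff f n) : ℂ))
      (∫ x, f (x + b) * conj (f x) ∂haarAddCircle) := by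
  let g : C(AddCircle T, ℂ) := ⟨fun x => f (x + b), by fun_prop⟩
  have h := (fourierBasis (T := T)).hasSum_inner_mul_inner
    (ContinuousMap.toLp 2 haarAddCircle ℂ f) (ContinuousMap.toLp 2 haarAddCircle ℂ g)
  rw [ContinuousMap.inner_toLp] at h
  refine h.congr_fun fun n => ?_
  rw [← inner_conj_symm, ← HilbertBasis.repr_apply_apply, ← HilbertBasis.repr_apply_apply,
    fourierBasis_repr, fourierBasis_repr, fourierCoeff_toLp, fourierCoeff_toLp,
    Complex.normSq_eq_conj_mul_self]
  change _ = _ * fourierCoeff (fun x => f (x + b)) n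
  rw [fourierCoeff_comp_add_right]
  ring

theorem fourierCoeff_ofReal_eq {p : ℝ → ℝ} (hp : Continuous p)
    [Fact (0 < 2 * π)] {f : AddCircle (2 * π) → ℂ} (hf : ∀ x : ℝ, f x = p x) (n : ℤ) :
    fourierCoeff f n = (1 / (2 * π) : ℝ) *
      ((∫ x in (0 : ℝ)..(2 * π), p x * cos (n * x) : ℝ) -
        (∫ x in (0 : ℝ)..(2 * π), p x * sin (n * x) : ℝ) * Complex.I) := by
  rw [fourierCoeff_eq_intervalIntegral f n 0, zero_add, Complex.real_smul,
    ← intervalIntegral.integral_ofReal, ← intervalIntegral.integral_ofReal,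
    ← intervalIntegral.integral_mul_const, ← intervalIntegral.integral_sub]
  · congr 1
    refine intervalIntegral.integral_congr fun x _ => ?_
    have hx : 2 * (π : ℂ) * Complex.I * ((-n : ℤ) : ℂ) * x / ((2 * π : ℝ) : ℂ) =
        ((-(n * x) : ℝ) : ℂ) * Complex.I := by
      have : (π : ℂ) ≠ 0 := by exact_mod_cast pi_ne_zero
      push_cast
      field_simp
    simp only [hf, fourier_coe_apply, smul_eq_mul]
    rw [hx, Complex.exp_mul_I, ← Complex.ofReal_cos, ← Complex.ofReal_sin, Real.cos_neg,
      Real.sin_neg]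
    push_cast
    ring
  · exact Continuous.intervalIntegrable (by fun_prop) _ _
  · exact Continuous.intervalIntegrable (by fun_prop) _ _

/-- For a continuous `2π`-periodic `p` with Fourier coefficients `a_k, b_k` and
`L = ∫₀^{2π} p`, for every `α`:
`∫₀^{2π} p(φ) p(φ + π - α) dφ = L²/(2π) - π Σ_{k ≥ 1} (-1)^{k+1} (a_k² + b_k²) cos(kα)`. -/
theorem support_product_integral (p : ℝ → ℝ) (hp : Continuous p)
    (hper : ∀ x : ℝ, p (x + 2 * π) = p x) (α : ℝ) :
    ∫ φ in (0 : ℝ)..(2 * π), p φ * p (φ + π - α) =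
      (∫ φ in (0 : ℝ)..(2 * π), p φ) ^ 2 / (2 * π) -
      π * ∑' m : ℕ, (-1 : ℝ) ^ m *
        ((((1 / π) * ∫ φ in (0 : ℝ)..(2 * π), p φ * Real.cos (((m + 1 : ℕ) : ℝ) * φ)) ^ 2 +
          ((1 / π) * ∫ φ in (0 : ℝ)..(2 * π), p φ * Real.sin (((m + 1 : ℕ) : ℝ) * φ)) ^ 2) *
         Real.cos (((m + 1 : ℕ) : ℝ) * α)) := by
  have : Fact (0 < 2 * π) := ⟨two_pi_pos⟩
  have hpi : π ≠ 0 := pi_ne_zero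
  have hper' : Function.Periodic (fun x => (p x : ℂ)) (2 * π) := fun x => by simp [hper]
  let f : C(AddCircle (2 * π), ℂ) :=
    ⟨hper'.lift, continuous_coinduced_dom.mpr (Complex.continuous_ofReal.comp hp)⟩
  have hf : ∀ x : ℝ, f x = p x := fun x => hper'.lift_coe x
  have hcorr : ∫ x, f (x + ((π - α : ℝ) : AddCircle (2 * π))) * conj (f x) ∂haarAddCircle =
      (((2 * π)⁻¹ * ∫ φ in (0 : ℝ)..(2 * π), p φ * p (φ + π - α) : ℝ) : ℂ) := by
    rw [integral_haarAddCircle, ← AddCircle.intervalIntegral_preimage (2 * π) 0, zero_add,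
      Complex.real_smul, Complex.ofReal_mul, ← intervalIntegral.integral_ofReal]
    congr 1
    refine intervalIntegral.integral_congr fun x _ => ?_
    simp only [← AddCircle.coe_add, hf, Complex.conj_ofReal, Complex.ofReal_mul, add_sub_assoc]
    ring
  let A : ℤ → ℝ := fun n => ∫ x in (0 : ℝ)..(2 * π), p x * cos (n * x)
  let B : ℤ → ℝ := fun n => ∫ x in (0 : ℝ)..(2 * π), p x * sin (n * x)
  have hA : ∀ n, A (-n) = A n := fun n => by simp [A]
  have hB : ∀ n, B (-n) = -B n := fun n => by simp [B]
  have hsum := Complex.hasSum_re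
    (hcorr ▸ hasSum_fourier_mul_normSq_fourierCoeff f ((π - α : ℝ) : AddCircle (2 * π)))
  have hterm : ∀ n : ℤ, (fourier n ((π - α : ℝ) : AddCircle (2 * π)) *
      (Complex.normSq (fourierCoeff f n) : ℂ)).re =
      cos (n * (π - α)) * ((1 / (2 * π)) ^ 2 * (A n ^ 2 + B n ^ 2)) := fun n => by
    have hx : 2 * (π : ℂ) * Complex.I * (n : ℂ) * ((π - α : ℝ) : ℂ) / ((2 * π : ℝ) : ℂ) =
        ((n * (π - α) : ℝ) : ℂ) * Complex.I := by
      have : (π : ℂ) ≠ 0 := by exact_mod_cast pi_ne_zero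
      push_cast
      field_simp
    rw [Complex.re_mul_ofReal, fourier_coe_apply, hx, Complex.exp_ofReal_mul_I_re,
      fourierCoeff_ofReal_eq hp hf, Complex.normSq_mul, Complex.normSq_ofReal,
      sub_eq_add_neg (Complex.ofReal _), ← neg_mul, ← Complex.ofReal_neg,
      Complex.normSq_add_mul_I]
    ring
  simp only [hterm, Complex.ofReal_re] at hsum
  have hnat := (hasSum_nat_add_iff' 1).mpr hsum.nat_add_neg
  have hA0 : A 0 = ∫ φ in (0 : ℝ)..(2 * π), p φ := by simp [A]
  have hB0 : B 0 = 0 := by simp [B]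
  have hseries := (hnat.mul_left (-2)).tsum_eq
  have hcos : ∀ m : ℕ, cos (((m + 1 : ℕ) : ℝ) * (π - α)) =
      -((-1) ^ m * cos (((m + 1 : ℕ) : ℝ) * α)) := fun m => by
    rw [mul_sub, cos_sub, cos_nat_mul_pi, sin_nat_mul_pi, pow_succ]
    ring
  have htsum : ∀ m : ℕ, (-1 : ℝ) ^ m *
        ((((1 / π) * ∫ φ in (0 : ℝ)..(2 * π), p φ * Real.cos (((m + 1 : ℕ) : ℝ) * φ)) ^ 2 +
          ((1 / π) * ∫ φ in (0 : ℝ)..(2 * π), p φ * Real.sin (((m + 1 : ℕ) : ℝ) * φ)) ^ 2) *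
         Real.cos (((m + 1 : ℕ) : ℝ) * α)) =
      -2 * (cos (((m + 1 : ℕ) : ℤ) * (π - α)) *
          ((1 / (2 * π)) ^ 2 * (A ((m + 1 : ℕ) : ℤ) ^ 2 + B ((m + 1 : ℕ) : ℤ) ^ 2)) +
        cos ((-((m + 1 : ℕ) : ℤ) : ℤ) * (π - α)) *
          ((1 / (2 * π)) ^ 2 * (A (-((m + 1 : ℕ) : ℤ)) ^ 2 + B (-((m + 1 : ℕ) : ℤ)) ^ 2))) :=
    fun m => by
    rw [hA, hB, Int.cast_neg, neg_mul (((m + 1 : ℕ) : ℤ) : ℝ), Real.cos_neg, Int.cast_natCast, hcos]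
    simp only [A, B, Int.cast_natCast]
    field_simp
    ring
  rw [tsum_congr htsum, hseries]
  simp [hA0, hB0]
  field_simp
  ring

end
end
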